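/- Let X be a complete separable connected median space of finite rank, let (Ω,μ) be a standard Borel probability space, and let M ⊆ Ω × X be a measurable subset (for the product σ-algebra, X carrying its Borel σ-algebra) such that for μ-almost every ω the fiber M_ω := {x ∈ X : (ω,x) ∈ M} is nonempty, bounded, and open. Then the map ω ↦ c(M_ω) assigning to ω the centroid of M_ω coincides μ-almost everywhere with a measurable map Ω → X. -/

import Mathlib

open Set Metric MeasureTheory

/-- The metric interval `[a,b]` in a metric space. -/
def mInterval {X : Type*} [MetricSpace X] (a b : X) : Set X :=
  {c : X | dist a b = dist a c + dist c b}

/-- A median space: each triple of points has a unique median point. -/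
def IsMedianSpace (X : Type*) [MetricSpace X] : Prop :=
  ∀ x y z : X, ∃! m : X, m ∈ mInterval x y ∧ m ∈ mInterval x z ∧ m ∈ mInterval y z

/-- Convexity with respect to metric intervals. -/
def MedConvex {X : Type*} [MetricSpace X] (C : Set X) : Prop :=
  ∀ a ∈ C, ∀ b ∈ C, mInterval a b ⊆ C

/-- A halfspace: a subset such that it and its complement are convex. -/
def IsHalfspace {X : Type*} [MetricSpace X] (h : Set X) : Prop :=
  MedConvex h ∧ MedConvex hᶜ

/-- Two halfspaces are transverse. -/
def Transverse {X : Type*} [MetricSpace X] (h₁ h₂ : Set X) : Prop :=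
  (h₁ ∩ h₂).Nonempty ∧ (h₁ ∩ h₂ᶜ).Nonempty ∧ (h₁ᶜ ∩ h₂).Nonempty ∧ (h₁ᶜ ∩ h₂ᶜ).Nonempty

/-- Finite rank: a uniform bound on families of pairwise transverse halfspaces. -/
def HasFiniteRank (X : Type*) [MetricSpace X] : Prop :=
  ∃ n : ℕ, ∀ H : Set (Set X), (∀ h ∈ H, IsHalfspace h) → H.Pairwise Transverse →
    H.Finite ∧ H.ncard ≤ n

/-- Depth of a halfspace `h` in a set `K`: `sup_{x ∈ K} d(x, hᶜ)`. -/
noncomputable def medDepth {X : Type*} [MetricSpace X] (K h : Set X) : ℝ :=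
  sSup ((fun x => Metric.infDist x hᶜ) '' K)

/-- The halfspaces that are at least as deep in `K` as their complements. -/
def HKplus {X : Type*} [MetricSpace X] (K : Set X) : Set (Set X) :=
  {h : Set X | IsHalfspace h ∧ h.Nonempty ∧ hᶜ.Nonempty ∧ medDepth K hᶜ ≤ medDepth K h}

/-- The centroid set of `K`: the intersection of the closures of the halfspaces in `HKplus K`. -/
noncomputable def centroidSet {X : Type*} [MetricSpace X] (K : Set X) : Set X :=
  ⋂ h ∈ HKplus K, closure h

open Set Metric MeasureTheory

namespace MedAux

variable {X : Type*} [MetricSpace X]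

lemma mem_iff {a b c : X} : c ∈ mInterval a b ↔ dist a b = dist a c + dist c b := Iff.rfl

lemma symm {a b c : X} (h : c ∈ mInterval a b) : c ∈ mInterval b a := by
  rw [mem_iff] at *
  rw [dist_comm b a, dist_comm b c, dist_comm c a]; linarith

lemma left_mem (a b : X) : a ∈ mInterval a b := by simp [mem_iff]
lemma right_mem (a b : X) : b ∈ mInterval a b := by simp [mem_iff]

lemma self_eq {a c : X} (h : c ∈ mInterval a a) : c = a := by
  rw [mem_iff, dist_self, dist_comm c a] at h
  have : dist a c = 0 := by have := dist_nonneg (x := a) (y := c); linarith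
  exact (dist_eq_zero.1 this).symm

lemma antisymm {a c d : X} (h : c ∈ mInterval a d) (h' : d ∈ mInterval a c) : c = d := by
  rw [mem_iff] at *
  rw [dist_comm d c] at h'
  have : dist c d = 0 := by have := dist_nonneg (x := c) (y := d); linarith
  exact dist_eq_zero.1 this

/-- order a d c b -/
lemma tr1 {a b c d : X} (h : c ∈ mInterval a b) (h' : d ∈ mInterval a c) : d ∈ mInterval a b := by
  rw [mem_iff] at *
  have := dist_triangle a d b
  have := dist_triangle d c b
  linarith

lemma tr2 {a b c d : X} (h : c ∈ mInterval a b) (h' : d ∈ mInterval a c) : c ∈ mInterval d b := by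
  rw [mem_iff] at *
  have := dist_triangle a d b
  have := dist_triangle d c b
  linarith

lemma inter_eq (hmed : IsMedianSpace X) {x y z m u : X} (h1 : m ∈ mInterval x y)
    (h2 : m ∈ mInterval x z) (h3 : m ∈ mInterval y z)
    (hu : u ∈ mInterval x y) (hu' : u ∈ mInterval x z) : u ∈ mInterval x m := by
  obtain ⟨m', ⟨a1, a2, a3⟩, -⟩ := hmed u y z
  have b1 : m' ∈ mInterval x y := symm (tr1 (symm hu) (symm a1))
  have b2 : m' ∈ mInterval x z := symm (tr1 (symm hu') (symm a2))
  have : m' = m := (hmed x y z).unique ⟨b1, b2, a3⟩ ⟨h1, h2, h3⟩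
  subst this
  exact symm (tr2 (symm hu) (symm a1))

/-- intervals are gated -/
lemma gate_int (hmed : IsMedianSpace X) {a b e w z : X} (h1 : w ∈ mInterval a b)
    (h2 : w ∈ mInterval a e) (h3 : w ∈ mInterval b e) (hz : z ∈ mInterval a b) :
    w ∈ mInterval e z := by
  obtain ⟨f, ⟨f1, f2, f3⟩, -⟩ := hmed a z e
  obtain ⟨g, ⟨g1, g2, g3⟩, -⟩ := hmed b z e
  obtain ⟨u, ⟨u1, u2, u3⟩, -⟩ := hmed f g e
  have c1 : u ∈ mInterval a e := symm (tr1 (symm f2) (symm u2))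
  have c2 : u ∈ mInterval b e := symm (tr1 (symm g2) (symm u3))
  have c3 : u ∈ mInterval a b := by
    rw [mem_iff] at *
    have := dist_triangle a u b
    have := dist_triangle a f u
    have := dist_triangle u g b
    have := dist_triangle f z g
    rw [dist_comm b z, dist_comm b g, dist_comm g z] at g1
    linarith
  have : u = w := (hmed a b e).unique ⟨c3, c1, c2⟩ ⟨h1, h2, h3⟩
  subst this
  exact tr1 (symm f3) (symm u2)

lemma int_convex (hmed : IsMedianSpace X) (a b : X) : MedConvex (mInterval a b) := by
  intro c hc d hd e he
  obtain ⟨w, ⟨w1, w2, w3⟩, -⟩ := hmed a b e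
  have h1 := gate_int hmed w1 w2 w3 hc
  have h2 := gate_int hmed w1 w2 w3 hd
  have : w = e := by
    rw [mem_iff] at *
    have := dist_triangle c w d
    rw [dist_comm e c, dist_comm w c] at h1
    have := dist_nonneg (x := e) (y := w)
    have : dist w e = 0 := by rw [dist_comm]; linarith
    exact dist_eq_zero.1 this
  exact this ▸ w1

lemma pasch (hmed : IsMedianSpace X) {a b a' b' f : X} (hb : b ∈ mInterval f a)
    (ha : a' ∈ mInterval f b') : ∃ s, s ∈ mInterval a a' ∧ s ∈ mInterval b b' := by
  obtain ⟨s, ⟨s1, s2, s3⟩, -⟩ := hmed a a' b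
  refine ⟨s, s1, ?_⟩
  obtain ⟨r, ⟨r1, r2, r3⟩, -⟩ := hmed b b' s
  obtain ⟨w, ⟨w1, w2, w3⟩, -⟩ := hmed f b' s
  have hbs : b ∈ mInterval f s := symm (tr2 (symm hb) s2)
  have hr : r ∈ mInterval s f := tr1 (symm hbs) (symm r2)
  have hrw : r ∈ mInterval s w := inter_eq hmed (symm w2) (symm w3) w1 hr (symm r3)
  have hw : w ∈ mInterval s a' := gate_int hmed w1 w2 w3 ha
  have hra : r ∈ mInterval s a' := tr1 hw hrw
  have hsr : s ∈ mInterval r a' := tr2 (symm s3) r2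
  have : r = s := by
    have h := antisymm (symm hra) (symm hsr)
    exact h
  exact this ▸ r1

lemma peano (hmed : IsMedianSpace X) {a f u v z : X} (hu : u ∈ mInterval a f)
    (hz : z ∈ mInterval u v) : ∃ y, y ∈ mInterval a v ∧ z ∈ mInterval y f := by
  obtain ⟨y, ⟨y1, y2, y3⟩, -⟩ := hmed a v z
  refine ⟨y, y1, ?_⟩
  obtain ⟨w, ⟨w1, w2, w3⟩, -⟩ := hmed y f z
  obtain ⟨g, ⟨g1, g2, g3⟩, -⟩ := hmed a f z
  have wa : w ∈ mInterval z a := tr1 (symm y2) (symm w2)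
  have wv : w ∈ mInterval z v := tr1 (symm y3) (symm w2)
  have wg : w ∈ mInterval z g := inter_eq hmed (symm g2) (symm g3) g1 wa (symm w3)
  have wu : w ∈ mInterval z u := tr1 (gate_int hmed g1 g2 g3 hu) wg
  have : w = z := by
    rw [mem_iff] at hz wu wv
    have := dist_triangle u w v
    rw [dist_comm z u, dist_comm w u] at wu
    have := dist_nonneg (x := z) (y := w)
    have : dist w z = 0 := by rw [dist_comm]; linarith
    exact dist_eq_zero.1 this
  exact this ▸ w1

lemma join_convex (hmed : IsMedianSpace X) {A : Set X} (hA : MedConvex A) (f : X) :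
    MedConvex {z | ∃ a ∈ A, z ∈ mInterval a f} := by
  rintro u ⟨a, ha, hu⟩ v ⟨a', ha', hv⟩ z hz
  obtain ⟨y, hy, hzy⟩ := peano hmed hu hz
  obtain ⟨a'', ha'', hya⟩ := peano hmed hv (symm hy)
  exact ⟨a'', hA _ ha' _ ha ha'', symm (tr1 (symm hya) (symm hzy))⟩

/-- Kakutani separation. -/
lemma kakutani (hmed : IsMedianSpace X) {A B : Set X} (hA : MedConvex A) (hB : MedConvex B)
    (hne : A.Nonempty) (hd : Disjoint A B) : ∃ h, IsHalfspace h ∧ A ⊆ h ∧ B ⊆ hᶜ := by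
  obtain ⟨h, hAh, hmax⟩ := zorn_subset_nonempty {C : Set X | MedConvex C ∧ Disjoint C B} (by
    intro c hc hch hcn
    refine ⟨⋃₀ c, ⟨?_, ?_⟩, fun s hs => subset_sUnion_of_mem hs⟩
    · rintro a ⟨s, hs, has⟩ b ⟨t, ht, hbt⟩
      rcases hch.total hs ht with hst | hst
      · exact ((hc ht).1 a (hst has) b hbt).trans (subset_sUnion_of_mem ht)
      · exact ((hc hs).1 a has b (hst hbt)).trans (subset_sUnion_of_mem hs)
    · rw [disjoint_sUnion_left]
      exact fun s hs => (hc hs).2) A ⟨hA, hd⟩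
  have hconv : MedConvex h := hmax.prop.1
  have hdis : Disjoint h B := hmax.prop.2
  have key : ∀ p ∉ h, ∃ a ∈ h, ∃ b ∈ B, b ∈ mInterval a p := by
    intro p hp
    by_contra hcon
    push Not at hcon
    have hJ : {z | ∃ a ∈ h, z ∈ mInterval a p} ∈ {C : Set X | MedConvex C ∧ Disjoint C B} := by
      refine ⟨join_convex hmed hconv p, ?_⟩
      rw [Set.disjoint_left]
      rintro z ⟨a, ha, hz⟩ hzB
      exact hcon a ha z hzB hz
    have hsub := hmax.le_of_ge hJ (fun a ha => ⟨a, ha, left_mem _ _⟩)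
    obtain ⟨a, ha⟩ := hne
    exact hp (hsub ⟨a, hAh ha, right_mem _ _⟩)
  refine ⟨h, ⟨hconv, ?_⟩, hAh, fun b hb hbh => Set.disjoint_left.1 hdis hbh hb⟩
  intro p hp q hq s hs hsh
  obtain ⟨a, ha, b, hb, hbap⟩ := key p hp
  obtain ⟨a', ha', b', hb', hbaq⟩ := key q hq
  obtain ⟨u, hu1, hu2⟩ := pasch hmed (symm hbap) hs
  obtain ⟨t, ht1, ht2⟩ := pasch hmed (symm hbaq) (symm hu2)
  have hu : u ∈ h := hconv _ ha _ hsh hu1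
  exact Set.disjoint_left.1 hdis (hconv _ ha' _ hu ht1) (hB _ hb' _ hb ht2)

lemma exists_on (hmed : IsMedianSpace X) [ConnectedSpace X] {x y : X} {t : ℝ} (h0 : 0 ≤ t)
    (h1 : t ≤ dist x y) : ∃ p ∈ mInterval x y, dist x p = t := by
  have hc : Continuous fun z => (dist x y + dist x z - dist y z) / 2 := by fun_prop
  have := intermediate_value_univ x y hc
  obtain ⟨z, hz⟩ := this (show t ∈ _ by
    simp only [dist_self, dist_comm y x]; constructor <;> linarith)
  obtain ⟨w, ⟨w1, w2, w3⟩, -⟩ := hmed x y z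
  refine ⟨w, w1, ?_⟩
  rw [mem_iff] at *
  rw [dist_comm y w] at w3
  simp only at hz
  linarith

lemma closure_convex (hmed : IsMedianSpace X) {C : Set X} (hC : MedConvex C) :
    MedConvex (closure C) := by
  intro a ha b hb e he
  rw [Metric.mem_closure_iff] at *
  intro ε hε
  obtain ⟨a', ha', haa⟩ := ha (ε/2) (by linarith)
  obtain ⟨b', hb', hbb⟩ := hb (ε/2) (by linarith)
  obtain ⟨w, ⟨w1, w2, w3⟩, -⟩ := hmed a' b' e
  refine ⟨w, hC _ ha' _ hb' w1, ?_⟩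
  rw [mem_iff] at *
  have := dist_triangle a a' b
  have := dist_triangle a' b' b
  have := dist_triangle a' a e
  have := dist_triangle b' b e
  simp only [dist_comm b' w, dist_comm a' a, dist_comm b' b, dist_comm e w, dist_comm e b] at *
  linarith

/-- gates onto closed convex sets -/
lemma gate_exists [CompleteSpace X] (hmed : IsMedianSpace X) {C : Set X} (hC : MedConvex C)
    (hcl : IsClosed C) (hne : C.Nonempty) (x : X) :
    ∃ p ∈ C, ∀ c ∈ C, p ∈ mInterval x c := by
  have hex : ∀ n : ℕ, ∃ c ∈ C, dist x c < infDist x C + (1/2)^n := fun n =>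
    (infDist_lt_iff hne).1 (by have : (0:ℝ) < (1/2)^n := by positivity
                               linarith)
  choose c hcC hc using hex
  have hcau : CauchySeq c := by
    refine cauchySeq_of_le_geometric (1/2) 2 (by norm_num) (fun n => ?_)
    obtain ⟨w, ⟨w1, w2, w3⟩, -⟩ := hmed (c n) (c (n+1)) x
    have hw := infDist_le_dist_of_mem (x := x) (hC _ (hcC n) _ (hcC (n+1)) w1)
    have h1 := hc n
    have h2 := hc (n+1)
    have h3 : ((1:ℝ)/2)^(n+1) ≤ (1/2)^n := pow_le_pow_of_le_one (by norm_num) (by norm_num) (by omega)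
    rw [mem_iff] at *
    simp only [dist_comm _ x] at *
    rw [dist_comm (c (n+1)) w] at w3
    linarith
  obtain ⟨p, hp⟩ := cauchySeq_tendsto_of_complete hcau
  have hpC : p ∈ C := hcl.mem_of_tendsto hp (Filter.Eventually.of_forall hcC)
  have hpd : dist x p ≤ infDist x C := by
    have l1 : Filter.Tendsto (fun n => dist x (c n)) Filter.atTop (nhds (dist x p)) :=
      tendsto_const_nhds.dist hp
    have l2 : Filter.Tendsto (fun n : ℕ => infDist x C + ((1:ℝ)/2)^n) Filter.atTop
        (nhds (infDist x C + 0)) :=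
      tendsto_const_nhds.add (tendsto_pow_atTop_nhds_zero_of_lt_one (by norm_num) (by norm_num))
    rw [add_zero] at l2
    exact le_of_tendsto_of_tendsto' l1 l2 (fun n => (hc n).le)
  refine ⟨p, hpC, fun d hd => ?_⟩
  obtain ⟨w, ⟨w1, w2, w3⟩, -⟩ := hmed x p d
  have hw := infDist_le_dist_of_mem (x := x) (hC _ hpC _ hd w3)
  have : w = p := by
    rw [mem_iff] at w1
    have : dist w p = 0 := by have := dist_nonneg (x := w) (y := p); linarith
    exact dist_eq_zero.1 this
  exact this ▸ w2

end MedAux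
namespace MedAux

variable {X : Type*} [MetricSpace X]

/-- convex hull -/
def hull (s : Set X) : Set X := ⋂₀ {C | MedConvex C ∧ s ⊆ C}

lemma hull_convex (s : Set X) : MedConvex (hull s) := by
  intro a ha b hb e he C hC
  exact hC.1 a (ha C hC) b (hb C hC) he

lemma subset_hull (s : Set X) : s ⊆ hull s := fun _ hx _ hC => hC.2 hx

lemma hull_min {s C : Set X} (h : s ⊆ C) (hC : MedConvex C) : hull s ⊆ C :=
  fun _ hx => hx C ⟨hC, h⟩

lemma hull_mono {s t : Set X} (h : s ⊆ t) : hull s ⊆ hull t :=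
  hull_min (h.trans (subset_hull t)) (hull_convex t)

lemma singleton_convex (x : X) : MedConvex ({x} : Set X) := by
  rintro a rfl b rfl e he
  exact self_eq he

lemma exists_finset {F : Set X} {z : X} (hz : z ∈ hull F) :
    ∃ S : Finset X, (S : Set X) ⊆ F ∧ z ∈ hull (S : Set X) := by
  classical
  have : hull F ⊆ {z | ∃ S : Finset X, (S : Set X) ⊆ F ∧ z ∈ hull (S : Set X)} := by
    apply hull_min
    · intro x hx
      exact ⟨{x}, by simpa using hx, subset_hull _ (by simp)⟩
    · rintro a ⟨S, hS, ha⟩ b ⟨T, hT, hb⟩ e he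
      refine ⟨S ∪ T, by simp [hS, hT], ?_⟩
      exact hull_convex _ a (hull_mono (by simp) ha) b (hull_mono (by simp) hb) he
  exact this hz

lemma finset_bound (hmed : IsMedianSpace X) (x : X) (R : ℝ) (S : Finset X) :
    (∀ y ∈ S, dist x y ≤ R) → ∀ z ∈ hull (insert x (S : Set X)), dist x z ≤ (2 ^ S.card - 1) * R := by
  classical
  induction S using Finset.induction_on with
  | empty =>
    intro _ z hz
    have : z ∈ ({x} : Set X) := hull_min (by simp) (singleton_convex x) hz
    rw [mem_singleton_iff] at this
    simp [this]
  | insert f S hf ih =>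
    intro hR z hz
    have hx : x ∈ hull (insert x (S : Set X)) := subset_hull _ (by simp)
    have : hull (insert x ((insert f S : Finset X) : Set X)) ⊆
        {z | ∃ a ∈ hull (insert x (S : Set X)), z ∈ mInterval a f} := by
      apply hull_min _ (join_convex hmed (hull_convex _) f)
      intro y hy
      simp only [Finset.coe_insert, mem_insert_iff] at hy
      rcases hy with rfl | rfl | hy
      · exact ⟨y, hx, left_mem _ _⟩
      · exact ⟨x, hx, right_mem _ _⟩
      · exact ⟨y, subset_hull _ (by simp [Finset.mem_coe.1 hy]), left_mem _ _⟩
    obtain ⟨a, ha, hza⟩ := this hz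
    have h1 := ih (fun y hy => hR y (Finset.mem_insert_of_mem hy)) a ha
    have h2 := hR f (Finset.mem_insert_self _ _)
    rw [Finset.card_insert_of_notMem hf, pow_succ]
    rw [mem_iff] at hza
    have t1 := dist_triangle x a z
    have t2 := dist_triangle a x f
    have t3 := dist_nonneg (x := z) (y := f)
    rw [dist_comm a x] at t2
    nlinarith

lemma hull_bound (hmed : IsMedianSpace X) (hrank : HasFiniteRank X) :
    ∃ C : ℝ, 0 < C ∧ ∀ (x : X) (R : ℝ) (F : Set X), 0 ≤ R → (∀ y ∈ F, dist x y ≤ R) →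
      ∀ z ∈ hull F, dist x z ≤ C * R := by
  classical
  obtain ⟨n, hn⟩ := hrank
  refine ⟨2 ^ n, by positivity, fun x R F hR hF z hz => ?_⟩
  obtain ⟨S0, hS0, hzS0⟩ := exists_finset hz
  have hex : ∃ k, ∃ S : Finset X, S.card = k ∧ (S : Set X) ⊆ F ∧ z ∈ hull (insert x (S : Set X)) :=
    ⟨_, S0, rfl, hS0, hull_mono (subset_insert _ _) hzS0⟩
  obtain ⟨S, hcard, hSF, hzS⟩ := Nat.find_spec hex
  have hmin : ∀ i ∈ S, z ∉ hull (insert x ((S.erase i : Finset X) : Set X)) := by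
    intro i hi hcon
    refine Nat.find_min hex (m := (S.erase i).card) ?_ ⟨S.erase i, rfl, ?_, hcon⟩
    · rw [← hcard]; exact Finset.card_erase_lt_of_mem hi
    · exact (Finset.coe_subset.2 (Finset.erase_subset i S)).trans hSF
  have hh : ∀ i : S, ∃ h : Set X, IsHalfspace h ∧ z ∈ h ∧ x ∉ h ∧ (i : X) ∈ h ∧
      ∀ j ∈ S, j ≠ i → j ∉ h := by
    rintro ⟨i, hi⟩
    obtain ⟨h, hh, h1, h2⟩ := kakutani hmed (singleton_convex z) (hull_convex _) ⟨z, rfl⟩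
      (Set.disjoint_singleton_left.2 (hmin i hi))
    have hsub : ∀ j ∈ S, j ≠ i → j ∉ h := fun j hj hji =>
      h2 (subset_hull _ (by simp [hj, hji]))
    have hxh : x ∉ h := h2 (subset_hull _ (by simp))
    refine ⟨h, hh, h1 rfl, hxh, ?_, hsub⟩
    by_contra hih
    have : hull (insert x (S : Set X)) ⊆ hᶜ := by
      apply hull_min _ hh.2
      intro y hy
      rcases hy with rfl | hy
      · exact hxh
      · by_cases hyi : y = i
        · exact hyi ▸ hih
        · exact hsub y hy hyi
    exact this hzS (h1 rfl)
  choose h hhalf hz hx hi hj using hh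
  have hinj : Function.Injective h := by
    intro i j hij
    by_contra hne
    exact hj j i i.2 (fun h => hne (Subtype.ext h)) (hij ▸ hi i)
  have hr := hn (Set.range h) (by rintro _ ⟨i, rfl⟩; exact hhalf i) (by
    rintro _ ⟨i, rfl⟩ _ ⟨j, rfl⟩ hne
    have hij : i ≠ j := fun h => hne (by rw [h])
    refine ⟨⟨z, hz i, hz j⟩, ⟨i, hi i, hj j i i.2 (fun h => hij (Subtype.ext h))⟩,
      ⟨j, hj i j j.2 (fun h => hij (Subtype.ext h.symm)), hi j⟩, ⟨x, hx i, hx j⟩⟩)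
  have hc : S.card ≤ n := by
    have := hr.2
    rw [← Set.image_univ, Set.ncard_image_of_injective _ hinj, Set.ncard_univ] at this
    simpa using this
  have hb := finset_bound hmed x R S (fun y hy => hF y (hSF hy)) z hzS
  have : (2:ℝ) ^ S.card ≤ 2 ^ n := pow_le_pow_right₀ (by norm_num) hc
  nlinarith

lemma helly_fin [CompleteSpace X] (hmed : IsMedianSpace X) {ι : Type*} {B : Set X}
    {C : ι → Set X} (hBc : MedConvex B) (hBne : B.Nonempty)
    (hC : ∀ i, MedConvex (C i)) (hCcl : ∀ i, IsClosed (C i)) (hBC : ∀ i, (B ∩ C i).Nonempty)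
    (hCC : ∀ i j, (C i ∩ C j).Nonempty) (S : Finset ι) :
    ∃ y ∈ B, ∀ i ∈ S, y ∈ C i := by
  classical
  induction S using Finset.induction_on with
  | empty => obtain ⟨y, hy⟩ := hBne; exact ⟨y, hy, by simp⟩
  | insert j S hj ih =>
    obtain ⟨y, hyB, hy⟩ := ih
    obtain ⟨c0, hc0⟩ := hBC j
    obtain ⟨p, hp, hg⟩ := gate_exists hmed (hC j) (hCcl j) ⟨c0, hc0.2⟩ y
    refine ⟨p, hBc _ hyB _ hc0.1 (hg _ hc0.2), fun i hi => ?_⟩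
    rcases Finset.mem_insert.1 hi with rfl | hi
    · exact hp
    · obtain ⟨c, hc⟩ := hCC i j
      exact hC i _ (hy i hi) _ hc.1 (hg _ hc.2)

lemma helly [CompleteSpace X] (hmed : IsMedianSpace X) {ι : Type*} {B : Set X}
    {C : ι → Set X} (hBc : MedConvex B) (hBcl : IsClosed B) (hBb : Bornology.IsBounded B)
    (hBne : B.Nonempty)
    (hC : ∀ i, MedConvex (C i)) (hCcl : ∀ i, IsClosed (C i)) (hBC : ∀ i, (B ∩ C i).Nonempty)
    (hCC : ∀ i j, (C i ∩ C j).Nonempty) : ∃ p, ∀ i, p ∈ C i := by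
  classical
  obtain ⟨x0, hx0⟩ := hBne
  have hgate : ∀ S : Finset ι, ∃ p, (p ∈ B ∧ ∀ i ∈ S, p ∈ C i) ∧
      ∀ c, (c ∈ B ∧ ∀ i ∈ S, c ∈ C i) → p ∈ mInterval x0 c := by
    intro S
    have hset : {p | p ∈ B ∧ ∀ i ∈ S, p ∈ C i} = B ∩ ⋂ i ∈ S, C i := by ext; simp
    obtain ⟨p, hp, hg⟩ := gate_exists (C := {p | p ∈ B ∧ ∀ i ∈ S, p ∈ C i}) hmed
      (fun a ha b hb e he => ⟨hBc a ha.1 b hb.1 he, fun i hi => hC i a (ha.2 i hi) b (hb.2 i hi) he⟩)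
      (by rw [hset]; exact hBcl.inter (isClosed_biInter fun i _ => hCcl i))
      (helly_fin hmed hBc ⟨x0, hx0⟩ hC hCcl hBC hCC S) x0
    exact ⟨p, hp, hg⟩
  choose u hu hug using hgate
  have hmono : ∀ S T : Finset ι, S ≤ T → u S ∈ mInterval x0 (u T) := fun S T hST =>
    hug S _ ⟨(hu T).1, fun i hi => (hu T).2 i (hST hi)⟩
  obtain ⟨R, hR⟩ := (Metric.isBounded_iff_subset_closedBall x0).1 hBb
  have hbdd : BddAbove (Set.range fun S => dist x0 (u S)) := by
    refine ⟨R, ?_⟩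
    rintro _ ⟨S, rfl⟩
    have := hR (hu S).1
    rw [mem_closedBall, dist_comm] at this
    exact this
  have hcau : CauchySeq u := by
    rw [Metric.cauchySeq_iff']
    intro ε hε
    obtain ⟨N, hN⟩ := exists_lt_of_lt_ciSup (f := fun S => dist x0 (u S))
      (show (⨆ S, dist x0 (u S)) - ε < ⨆ S, dist x0 (u S) by linarith)
    refine ⟨N, fun T hT => ?_⟩
    have h1 := le_ciSup hbdd T
    have h2 := hmono N T hT
    rw [mem_iff] at h2
    rw [dist_comm]
    linarith
  obtain ⟨p, hp⟩ := cauchySeq_tendsto_of_complete hcau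
  refine ⟨p, fun i => (hCcl i).mem_of_tendsto hp ?_⟩
  filter_upwards [Filter.eventually_ge_atTop {i}] with S hS
  exact (hu S).2 i (hS (by simp))

/-- disjoint nonempty closed convex sets are at positive distance -/
lemma pos_dist [CompleteSpace X] (hmed : IsMedianSpace X) {C D : Set X} (hC : MedConvex C)
    (hD : MedConvex D) (hCc : IsClosed C) (hDc : IsClosed D) (hCn : C.Nonempty) (hDn : D.Nonempty)
    (hdis : ¬ (C ∩ D).Nonempty) : ∃ δ > 0, ∀ z ∈ C, ∀ v ∈ D, δ ≤ dist z v := by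
  obtain ⟨x, hx⟩ := hCn
  obtain ⟨y, hy, hyg⟩ := gate_exists hmed hD hDc hDn x
  obtain ⟨x', hx', hxg⟩ := gate_exists hmed hC hCc ⟨x, hx⟩ y
  obtain ⟨y', hy', hyg'⟩ := gate_exists hmed hD hDc hDn x'
  have e1 := hyg y' hy'
  have e2 := hxg x hx
  have e3 := hyg' y hy
  have hyy : y' = y := by
    rw [mem_iff] at e1 e2 e3
    have := dist_triangle x x' y'
    simp only [dist_comm y x, dist_comm y x', dist_comm x' x, dist_comm y' y] at *
    have : dist y y' = 0 := by have := dist_nonneg (x := y) (y := y'); linarith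
    exact (dist_eq_zero.1 this).symm
  subst hyy
  refine ⟨dist x' y', dist_pos.2 (fun h => hdis ⟨x', hx', h ▸ hy'⟩), fun z hz v hv => ?_⟩
  have f1 := hxg z hz
  have f2 := hyg' v hv
  rw [mem_iff] at f1 f2
  have := dist_triangle x' z v
  have := dist_triangle y' v z
  simp only [dist_comm y' x', dist_comm v z] at *
  linarith

end MedAux
namespace MedAux

variable {X : Type*} [MetricSpace X]

lemma bdd_depth {K : Set X} (hK : Bornology.IsBounded K) {h : Set X} (hne : h.Nonempty) :
    BddAbove ((fun x => infDist x h) '' K) := by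
  obtain ⟨y, hy⟩ := hne
  obtain ⟨R, hR⟩ := (Metric.isBounded_iff_subset_closedBall y).1 hK
  refine ⟨R, ?_⟩
  rintro _ ⟨x, hx, rfl⟩
  exact (infDist_le_dist_of_mem hy).trans (hR hx)

lemma le_depth {K : Set X} (hK : Bornology.IsBounded K) {h : Set X} (hne : hᶜ.Nonempty) {x : X}
    (hx : x ∈ K) : infDist x hᶜ ≤ medDepth K h :=
  le_csSup (bdd_depth hK hne) ⟨x, hx, rfl⟩

lemma depth_le {K : Set X} (hne : K.Nonempty) {h : Set X} {t : ℝ}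
    (ht : ∀ x ∈ K, infDist x hᶜ ≤ t) : medDepth K h ≤ t := by
  refine csSup_le (hne.image _) ?_
  rintro _ ⟨x, hx, rfl⟩
  exact ht x hx

lemma meets {K : Set X} (hK : Bornology.IsBounded K) (hne : K.Nonempty) (ho : IsOpen K)
    {h : Set X} (hh : h ∈ HKplus K) : (K ∩ h).Nonempty := by
  by_contra hcon
  obtain ⟨x, hx⟩ := hne
  obtain ⟨-, h1, h2, h3⟩ := hh
  have d0 : medDepth K h ≤ 0 := depth_le ⟨x, hx⟩ (fun y hy => by
    rw [infDist_zero_of_mem]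
    exact fun hyh => hcon ⟨y, hy, hyh⟩)
  have d1 := le_depth (h := hᶜ) hK (by rwa [compl_compl]) hx
  rw [compl_compl] at d1
  have : infDist x h = 0 := le_antisymm (by linarith) infDist_nonneg
  have hxc : x ∈ closure h := (mem_closure_iff_infDist_zero h1).2 this
  exact hcon (mem_closure_iff.1 hxc K ho hx)

lemma pairwise_meet [CompleteSpace X] [ConnectedSpace X] (hmed : IsMedianSpace X) {K : Set X}
    (hK : Bornology.IsBounded K) (hne : K.Nonempty) (ho : IsOpen K)
    {h k : Set X} (hh : h ∈ HKplus K) (hk : k ∈ HKplus K) : (closure h ∩ closure k).Nonempty := by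
  by_contra hcon
  obtain ⟨x, hxK, hxh⟩ := meets hK hne ho hh
  obtain ⟨⟨hc, -⟩, h1, h2, h3⟩ := hh
  obtain ⟨⟨kc, -⟩, k1, k2, k3⟩ := hk
  obtain ⟨δ, hδ, hd⟩ := pos_dist hmed (closure_convex hmed hc) (closure_convex hmed kc)
    isClosed_closure isClosed_closure h1.closure k1.closure hcon
  have hdis : ∀ z ∈ h, z ∉ k := fun z hz hz' => hcon ⟨z, subset_closure hz, subset_closure hz'⟩
  have key : ∀ z ∈ h, infDist z hᶜ + δ ≤ infDist z k := by
    intro z hz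
    rw [le_infDist k1]
    intro v hv
    have hvh : infDist z hᶜ ≤ dist z v := infDist_le_dist_of_mem (fun hvh => hdis v hvh hv)
    by_contra hlt
    push Not at hlt
    have hzv := hd z (subset_closure hz) v (subset_closure hv)
    -- pick t with max(0, d(z,v) - δ) < t < infDist
    obtain ⟨p, hp, hpt⟩ := exists_on hmed (x := z) (y := v)
      (t := (dist z v - δ + infDist z hᶜ) / 2) (by
        have := infDist_nonneg (x := z) (s := hᶜ); linarith) (by linarith)
    have hph : p ∈ h := by
      by_contra hph
      have := infDist_le_dist_of_mem (x := z) (s := hᶜ) hph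
      linarith
    have := hd p (subset_closure hph) v (subset_closure hv)
    rw [mem_iff] at hp
    linarith
  have c0 : k ⊆ hᶜ := fun z hz hz' => hdis z hz' hz
  have c1 : h ⊆ kᶜ := fun z hz hz' => hdis z hz hz'
  -- depth h + δ ≤ depth kᶜ
  have kk : kᶜᶜ.Nonempty := by rwa [compl_compl]
  have s1 : medDepth K h ≤ medDepth K kᶜ - δ := by
    refine depth_le hne fun y hy => ?_
    by_cases hyh : y ∈ h
    · have a := le_depth (h := kᶜ) hK kk hy
      rw [compl_compl] at a
      have := key y hyh
      linarith
    · rw [infDist_zero_of_mem (show y ∈ hᶜ from hyh)]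
      have a := le_depth (h := kᶜ) hK kk hxK
      rw [compl_compl] at a
      have := key x hxh
      have := infDist_nonneg (x := x) (s := hᶜ)
      linarith
  have s2 : medDepth K k ≤ medDepth K hᶜ := by
    refine depth_le hne fun y hy => ?_
    have a := le_depth (h := hᶜ) hK (by rwa [compl_compl]) hy
    rw [compl_compl] at a
    exact (infDist_le_infDist_of_subset c1 h1).trans a
  linarith

lemma centroid_exists [CompleteSpace X] [ConnectedSpace X] (hmed : IsMedianSpace X)
    (hrank : HasFiniteRank X) {K : Set X}
    (hK : Bornology.IsBounded K) (hne : K.Nonempty) (ho : IsOpen K) :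
    (centroidSet K).Nonempty := by
  obtain ⟨c, hc, hb⟩ := hull_bound hmed hrank
  have hbd : Bornology.IsBounded (hull K) := by
    obtain ⟨x, hx⟩ := hne
    obtain ⟨R, hR⟩ := (Metric.isBounded_iff_subset_closedBall x).1 hK
    have hR0 : 0 ≤ R := by simpa using hR hx
    refine (Metric.isBounded_iff_subset_closedBall x).2 ⟨c * R, fun z hz => ?_⟩
    rw [mem_closedBall, dist_comm]
    refine hb x R K hR0 (fun y hy => ?_) z hz
    rw [dist_comm]; exact hR hy
  obtain ⟨p, hp⟩ := helly (ι := HKplus K) (B := closure (hull K)) (C := fun h => closure h.1) hmed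
    (closure_convex hmed (hull_convex K)) isClosed_closure hbd.closure
    (hne.mono ((subset_hull K).trans subset_closure))
    (fun h => closure_convex hmed h.2.1.1) (fun h => isClosed_closure)
    (fun h => (meets hK hne ho h.2).mono
      (inter_subset_inter ((subset_hull K).trans subset_closure) subset_closure))
    (fun h k => pairwise_meet hmed hK hne ho h.2 k.2)
  refine ⟨p, ?_⟩
  simp only [centroidSet, mem_iInter]
  exact fun h hh => hp ⟨h, hh⟩

/-- a countable family of halfspaces separating points robustly -/
lemma countable_family [TopologicalSpace.SeparableSpace X] [Nonempty X] (hmed : IsMedianSpace X)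
    (hrank : HasFiniteRank X) :
    ∃ H : ℕ × ℕ × ℕ → Set X, ∀ x y : X, x ≠ y → ∃ i, IsHalfspace (H i) ∧ x ∉ closure (H i)ᶜ ∧
      y ∉ closure (H i) := by
  classical
  obtain ⟨c, hc, hb⟩ := hull_bound hmed hrank
  let D := TopologicalSpace.denseSeq X
  have hD : DenseRange D := TopologicalSpace.denseRange_denseSeq X
  let P : ℕ × ℕ × ℕ → Set X → Prop := fun i h =>
    IsHalfspace h ∧ ball (D i.1) (1 / (i.2.2 + 1)) ⊆ h ∧ ball (D i.2.1) (1 / (i.2.2 + 1)) ⊆ hᶜ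
  refine ⟨fun i => if hi : ∃ h, P i h then hi.choose else ∅, fun x y hxy => ?_⟩
  have hpos : 0 < dist x y := dist_pos.2 hxy
  obtain ⟨n, hn⟩ := exists_nat_one_div_lt (show 0 < dist x y / (2 * c + 2) by positivity)
  set ε : ℝ := 1 / ((n:ℝ) + 1) with hε
  have hε0 : 0 < ε := by positivity
  rw [lt_div_iff₀ (by positivity)] at hn
  obtain ⟨i, hi⟩ := hD.exists_dist_lt x hε0
  obtain ⟨j, hj⟩ := hD.exists_dist_lt y hε0
  have hex : ∃ h, P (i, j, n) h := by
    obtain ⟨h, hh, h1, h2⟩ := kakutani hmed (hull_convex (ball (D i) ε)) (hull_convex (ball (D j) ε))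
      ⟨D i, subset_hull _ (mem_ball_self hε0)⟩ (by
        rw [Set.disjoint_left]
        intro z hz hz'
        have b1 := hb (D i) ε _ hε0.le (fun y hy => by rw [dist_comm]; exact (mem_ball.1 hy).le) z hz
        have b2 := hb (D j) ε _ hε0.le (fun y hy => by rw [dist_comm]; exact (mem_ball.1 hy).le) z hz'
        have t1 := dist_triangle x (D i) y
        have t2 := dist_triangle (D i) z y
        have t3 := dist_triangle z (D j) y
        rw [dist_comm z (D j), dist_comm (D j) y] at t3
        linarith)
    exact ⟨h, hh, (subset_hull _).trans h1, (subset_hull _).trans h2⟩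
  refine ⟨(i, j, n), ?_⟩
  simp only [dif_pos hex]
  obtain ⟨g1, g2, g3⟩ := hex.choose_spec
  refine ⟨g1, fun hcl => ?_, fun hcl => ?_⟩
  · obtain ⟨z, hz, hz'⟩ := mem_closure_iff.1 hcl _ isOpen_ball (show x ∈ ball (D i) ε from hi)
    exact hz' (g2 hz)
  · obtain ⟨z, hz, hz'⟩ := mem_closure_iff.1 hcl _ isOpen_ball (show y ∈ ball (D j) ε from hj)
    exact g3 hz hz'

lemma depth_iff {K : Set X} (hK : Bornology.IsBounded K) (hne : K.Nonempty) (ho : IsOpen K)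
    {D : ℕ → X} (hD : DenseRange D) {h : Set X} (hn : hᶜ.Nonempty) (q : ℝ) :
    q < medDepth K h ↔ ∃ n, D n ∈ K ∧ q < infDist (D n) hᶜ := by
  constructor
  · intro hq
    obtain ⟨_, ⟨x, hx, rfl⟩, hlt⟩ := exists_lt_of_lt_csSup (hne.image _) hq
    obtain ⟨n, hn⟩ := hD.exists_mem_open
      (ho.inter (isOpen_lt continuous_const (continuous_infDist_pt hᶜ))) ⟨x, hx, hlt⟩
    exact ⟨n, hn.1, hn.2⟩
  · rintro ⟨n, h1, h2⟩
    exact h2.trans_le (le_depth hK hn h1)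

end MedAux

open MedAux
/-- Measurability of the centroid map of a measurable field of nonempty,
bounded, open fibers in a complete separable connected median space of finite rank. -/
theorem stmt11 {X : Type*} [MetricSpace X] [CompleteSpace X]
    [TopologicalSpace.SeparableSpace X] [ConnectedSpace X]
    [MeasurableSpace X] [BorelSpace X]
    (hmed : IsMedianSpace X) (hrank : HasFiniteRank X)
    {Ω : Type*} [MeasurableSpace Ω] [StandardBorelSpace Ω]
    (μ : Measure Ω) [IsProbabilityMeasure μ]
    (M : Set (Ω × X)) (hM : MeasurableSet M)
    (hfib : ∀ᵐ ω ∂μ, ({x : X | (ω, x) ∈ M}).Nonempty ∧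
      Bornology.IsBounded {x : X | (ω, x) ∈ M} ∧ IsOpen {x : X | (ω, x) ∈ M}) :
    ∃ F : Ω → X, Measurable F ∧
      ∀ᵐ ω ∂μ, centroidSet {x : X | (ω, x) ∈ M} = {F ω} := by
  classical
  obtain ⟨H, hH⟩ := countable_family hmed hrank
  let D := TopologicalSpace.denseSeq X
  have hD : DenseRange D := TopologicalSpace.denseRange_denseSeq X
  -- good set
  let good : Ω → Prop := fun ω => ({x : X | (ω, x) ∈ M}).Nonempty ∧
      Bornology.IsBounded {x : X | (ω, x) ∈ M} ∧ IsOpen {x : X | (ω, x) ∈ M}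
  have hN : μ {ω | ¬ good ω} = 0 := hfib
  let Ω₀ : Set Ω := (toMeasurable μ {ω | ¬ good ω})ᶜ
  have hΩm : MeasurableSet Ω₀ := (measurableSet_toMeasurable _ _).compl
  have hΩ0 : ∀ᵐ ω ∂μ, ω ∈ Ω₀ := by
    have : μ Ω₀ᶜ = 0 := by
      simp only [Ω₀, compl_compl]; rw [measure_toMeasurable]; exact hN
    exact this
  have hgood : ∀ ω ∈ Ω₀, good ω := by
    intro ω hω
    by_contra hcon
    exact hω (subset_toMeasurable _ _ hcon)
  -- deeper condition
  let Q : Set X → Ω → Prop := fun h ω => ∀ q : ℚ, (∃ n, (ω, D n) ∈ M ∧ (q : ℝ) < infDist (D n) h) →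
    (∃ n, (ω, D n) ∈ M ∧ (q : ℝ) < infDist (D n) hᶜ)
  have hQ : ∀ h : Set X, h.Nonempty → hᶜ.Nonempty → ∀ ω ∈ Ω₀,
      (Q h ω ↔ medDepth {x : X | (ω, x) ∈ M} hᶜ ≤ medDepth {x : X | (ω, x) ∈ M} h) := by
    intro h h1 h2 ω hω
    obtain ⟨g1, g2, g3⟩ := hgood ω hω
    have e1 := fun q : ℝ => depth_iff g2 g1 g3 hD h2 q
    have e2 := fun q : ℝ => depth_iff g2 g1 g3 hD (h := hᶜ) (by rwa [compl_compl]) q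
    simp only [compl_compl] at e2
    have : Q h ω ↔ ∀ q : ℚ, (q : ℝ) < medDepth {x : X | (ω, x) ∈ M} hᶜ →
        (q : ℝ) < medDepth {x : X | (ω, x) ∈ M} h := by
      refine forall_congr' fun q => ?_
      rw [e1, e2]; rfl
    rw [this]
    constructor
    · intro hq
      by_contra hlt
      push Not at hlt
      obtain ⟨q, q1, q2⟩ := exists_rat_btwn hlt
      exact absurd (hq q q2) (not_lt.2 q1.le)
    · exact fun hle q hq => hq.trans_le hle
  have hQm : ∀ h, MeasurableSet {ω | Q h ω} := by
    intro h
    have hs : ∀ n, MeasurableSet {ω | (ω, D n) ∈ M} := fun n =>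
      hM.preimage (measurable_id.prodMk measurable_const)
    have hP : ∀ (h : Set X) (q : ℚ), MeasurableSet {ω | ∃ n, (ω, D n) ∈ M ∧ (q : ℝ) < infDist (D n) h} := by
      intro h q
      simp only [Set.ofPred_exists]
      exact MeasurableSet.iUnion fun n => (hs n).inter (MeasurableSet.const _)
    simp only [Q, Set.ofPred_forall]
    exact MeasurableSet.iInter fun q => (hP h q).himp (hP hᶜ q)
  -- the graph
  let fam : (ℕ × ℕ × ℕ) × Bool → Set X := fun i => if i.2 then H i.1 else (H i.1)ᶜ
  let ok : Set ((ℕ × ℕ × ℕ) × Bool) := {i | IsHalfspace (fam i) ∧ (fam i).Nonempty ∧ (fam i)ᶜ.Nonempty}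
  let G : Set (Ω × X) := {p | p.1 ∈ Ω₀ ∧ ∀ i ∈ ok, Q (fam i) p.1 → p.2 ∈ closure (fam i)}
  have hGm : MeasurableSet G := by
    suffices h2 : MeasurableSet {p : Ω × X | ∀ i ∈ ok, Q (fam i) p.1 → p.2 ∈ closure (fam i)} from
      (measurable_fst hΩm).inter h2
    simp only [Set.ofPred_forall]
    refine MeasurableSet.iInter fun i => MeasurableSet.iInter fun _ => ?_
    exact (measurable_fst (hQm (fam i))).himp (measurable_snd isClosed_closure.measurableSet)
  have huniq : ∀ ω x y, (ω, x) ∈ G → (ω, y) ∈ G → x = y := by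
    rintro ω x y ⟨hω, hx⟩ ⟨-, hy⟩
    by_contra hxy
    obtain ⟨i, hi, hxi, hyi⟩ := hH x y hxy
    have n1 : (H i).Nonempty := by
      by_contra hcon
      rw [not_nonempty_iff_eq_empty] at hcon
      exact hxi (by simp [hcon])
    have n2 : (H i)ᶜ.Nonempty := by
      by_contra hcon
      rw [not_nonempty_iff_eq_empty, compl_empty_iff] at hcon
      exact hyi (by simp [hcon])
    have hi' : IsHalfspace (H i)ᶜ := ⟨hi.2, by rw [compl_compl]; exact hi.1⟩
    rcases le_total (medDepth {x : X | (ω, x) ∈ M} (H i)ᶜ) (medDepth {x : X | (ω, x) ∈ M} (H i))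
      with hle | hle
    · exact hyi (hy (i, true) ⟨hi, n1, n2⟩ ((hQ _ n1 n2 ω hω).2 hle))
    · refine hxi (hx (i, false) ⟨hi', n2, ?_⟩ ((hQ _ n2 ?_ ω hω).2 ?_))
      · simpa [fam] using n1
      · simpa [fam] using n1
      · simpa [fam] using hle
  have hsub : ∀ ω ∈ Ω₀, ∀ x ∈ centroidSet {x : X | (ω, x) ∈ M}, (ω, x) ∈ G := by
    intro ω hω x hx
    refine ⟨hω, fun i hi hq => ?_⟩
    simp only [centroidSet, mem_iInter] at hx
    exact hx _ ⟨hi.1, hi.2.1, hi.2.2, (hQ _ hi.2.1 hi.2.2 ω hω).1 hq⟩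
  have hcen : ∀ ω ∈ Ω₀, (centroidSet {x : X | (ω, x) ∈ M}).Nonempty := by
    intro ω hω
    obtain ⟨g1, g2, g3⟩ := hgood ω hω
    exact centroid_exists hmed hrank g2 g1 g3
  let x0 : X := D 0
  let F : Ω → X := fun ω => if hω : ω ∈ Ω₀ then (hcen ω hω).choose else x0
  have hF : ∀ ω ∈ Ω₀, F ω ∈ centroidSet {x : X | (ω, x) ∈ M} := by
    intro ω hω
    simp only [F, dif_pos hω]
    exact (hcen ω hω).choose_spec
  refine ⟨F, ?_, ?_⟩
  · intro U hU
    have himg : MeasurableSet (Prod.fst '' (G ∩ Prod.snd ⁻¹' U)) := by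
      refine (hGm.inter (measurable_snd hU)).image_of_measurable_injOn measurable_fst ?_
      rintro ⟨ω, x⟩ hx ⟨ω', y⟩ hy hxy
      simp only at hxy
      subst hxy
      rw [huniq ω x y hx.1 hy.1]
    have heq : F ⁻¹' U = (Prod.fst '' (G ∩ Prod.snd ⁻¹' U)) ∪ (Ω₀ᶜ ∩ {_ω | x0 ∈ U}) := by
      ext ω
      by_cases hω : ω ∈ Ω₀
      · simp only [mem_preimage, mem_union, mem_inter_iff, mem_compl_iff, hω, not_true_eq_false,
          false_and, or_false]
        constructor
        · intro h
          exact ⟨(ω, F ω), ⟨hsub ω hω _ (hF ω hω), h⟩, rfl⟩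
        · rintro ⟨⟨ω', y⟩, ⟨h1, h2⟩, rfl⟩
          rw [huniq ω' (F ω') y (hsub _ hω _ (hF _ hω)) h1]
          exact h2
      · have : F ω = x0 := by simp only [F, dif_neg hω]
        simp only [mem_preimage, this, mem_union, mem_inter_iff, mem_compl_iff, hω,
          not_false_eq_true, true_and, Set.mem_ofPred_eq]
        constructor
        · exact fun h => Or.inr h
        · rintro (⟨⟨ω', y⟩, ⟨h1, h2⟩, rfl⟩ | h)
          · exact absurd h1.1 hω
          · exact h
    rw [heq]
    exact himg.union (hΩm.compl.inter (MeasurableSet.const _))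
  · filter_upwards [hΩ0] with ω hω
    refine Set.eq_singleton_iff_unique_mem.2 ⟨hF ω hω, fun y hy => ?_⟩
    exact huniq ω y (F ω) (hsub ω hω y hy) (hsub ω hω _ (hF ω hω))
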